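/- arXiv:2408.13246 — 9 statements merged into one kernel-verified Lean document; each statement's English description precedes it below -/
import Mathlib

section
/- For all ν, c ∈ ℂ and all z ∈ ℂ with z ≠ 0: z³ E_{ν,c}(z) = c z³ E_{ν+1,c}(z) + (ν+1)(ν+2)(ν+3) · ( E_{ν+3,c}(z) − c E_{ν+4,c}(z) ). -/
/-- The complex Miller-Ross function `E_{ν,c}(z) = z^ν ∑_{n=0}^∞ (cz)^n / Γ(ν+n+1)`,
using the principal complex power and the convention `1/Γ(m) = 0` at nonpositive
integers `m` (in Mathlib `Complex.Gamma` vanishes there, and division by `0` is `0`). -/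
noncomputable def millerRoss (ν c z : ℂ) : ℂ :=
  z ^ ν * ∑' n : ℕ, (c * z) ^ n / Complex.Gamma (ν + n + 1)

theorem summable_pow_div_Gamma (ν w : ℂ) :
    Summable fun n : ℕ => w ^ n / Complex.Gamma (ν + n + 1) := by
  refine summable_of_ratio_norm_eventually_le (r := 1 / 2) (by norm_num) ?_
  have hlarge : ∀ᶠ n : ℕ in Filter.atTop, 2 * ‖w‖ + ‖ν + 1‖ + 1 ≤ (n : ℝ) :=
    tendsto_natCast_atTop_atTop.eventually_ge_atTop _
  filter_upwards [hlarge] with n hn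
  have hnorm : 2 * ‖w‖ ≤ ‖ν + n + 1‖ := by
    have h := norm_sub_le (ν + n + 1) (ν + 1)
    rw [show ν + n + 1 - (ν + 1) = (n : ℂ) by ring, Complex.norm_natCast] at h
    linarith
  have hΓ := Complex.one_div_Gamma_eq_self_mul_one_div_Gamma_add_one (ν + n + 1)
  have hstep : ν + (n + 1 : ℕ) + 1 = ν + n + 1 + 1 := by push_cast; ring
  rw [hstep, div_eq_mul_inv, div_eq_mul_inv (w ^ n), hΓ, pow_succ]
  simp only [norm_mul]
  nlinarith [mul_le_mul_of_nonneg_left hnorm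
    (mul_nonneg (norm_nonneg (w ^ n)) (norm_nonneg (Complex.Gamma (ν + n + 1 + 1))⁻¹))]

theorem millerRoss_sub_mul_millerRoss_add_one (ν c z : ℂ) (hz : z ≠ 0) :
    millerRoss ν c z - c * millerRoss (ν + 1) c z = z ^ ν * (Complex.Gamma (ν + 1))⁻¹ := by
  have hsum : ∑' n : ℕ, (c * z) ^ n / Complex.Gamma (ν + n + 1) =
      (Complex.Gamma (ν + 1))⁻¹ +
        c * z * ∑' n : ℕ, (c * z) ^ n / Complex.Gamma (ν + 1 + n + 1) := by
    rw [(summable_pow_div_Gamma ν (c * z)).tsum_eq_zero_add, ← tsum_mul_left]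
    congr 1
    · simp
    · refine tsum_congr fun n => ?_
      rw [show ν + (n + 1 : ℕ) + 1 = ν + 1 + n + 1 by push_cast; ring]
      ring
  rw [millerRoss, millerRoss, hsum, Complex.cpow_add _ _ hz, Complex.cpow_one]
  ring

/-- Recurrence: `z³ E_{ν,c}(z) = c z³ E_{ν+1,c}(z)
  + (ν+1)(ν+2)(ν+3)(E_{ν+3,c}(z) − c E_{ν+4,c}(z))`. -/
theorem millerRoss_rec_ii (ν c z : ℂ) (hz : z ≠ 0) :
    z ^ 3 * millerRoss ν c z =
      c * z ^ 3 * millerRoss (ν + 1) c z +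
        (ν + 1) * (ν + 2) * (ν + 3) *
          (millerRoss (ν + 3) c z - c * millerRoss (ν + 4) c z) := by
  have h3 : z ^ (ν + 3) = z ^ ν * z ^ 3 := by
    rw [Complex.cpow_add _ _ hz]
    norm_cast
  have e1 := millerRoss_sub_mul_millerRoss_add_one ν c z hz
  have e2 := millerRoss_sub_mul_millerRoss_add_one (ν + 3) c z hz
  rw [show ν + 3 + 1 = ν + 4 by ring, h3] at e2
  have g1 := Complex.one_div_Gamma_eq_self_mul_one_div_Gamma_add_one (ν + 1)
  have g2 := Complex.one_div_Gamma_eq_self_mul_one_div_Gamma_add_one (ν + 2)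
  have g3 := Complex.one_div_Gamma_eq_self_mul_one_div_Gamma_add_one (ν + 3)
  rw [show ν + 1 + 1 = ν + 2 by ring] at g1
  rw [show ν + 2 + 1 = ν + 3 by ring] at g2
  rw [show ν + 3 + 1 = ν + 4 by ring] at g3
  rw [g1, g2, g3] at e1
  linear_combination z ^ 3 * e1 - (ν + 1) * (ν + 2) * (ν + 3) * e2
end

section
/- For all ν, c ∈ ℂ and all z ∈ ℂ with z ≠ 0: z² E_{ν,c}(z) = z^{ν+2}/Γ(ν+1) + c² z² E_{ν+2,c}(z) + c (ν+2)(ν+3) · ( E_{ν+3,c}(z) − c E_{ν+4,c}(z) ). -/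
theorem millerRoss_summable (a x : ℂ) :
    Summable fun n : ℕ => x ^ n / Complex.Gamma (a + n + 1) := by
  refine summable_of_ratio_norm_eventually_le (r := 1 / 2) (by norm_num) ?_
  filter_upwards [Filter.eventually_ge_atTop ⌈2 * ‖x‖ + ‖a‖⌉₊] with n hn
  have hn' : 2 * ‖x‖ + ‖a‖ ≤ (n : ℝ) := Nat.ceil_le.mp hn
  have hlow : 2 * ‖x‖ + 1 ≤ ‖a + n + 1‖ := by
    have h := norm_sub_le (a + n + 1) a
    have e : a + n + 1 - a = ((n + 1 : ℕ) : ℂ) := by push_cast; ring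
    rw [e, Complex.norm_natCast] at h
    push_cast at h
    linarith
  have hrec : (a + n + 1) * (x ^ (n + 1) / Complex.Gamma (a + (n + 1 : ℕ) + 1)) =
      x * (x ^ n / Complex.Gamma (a + n + 1)) := by
    have h := Complex.one_div_Gamma_eq_self_mul_one_div_Gamma_add_one (a + n + 1)
    rw [show a + ((n + 1 : ℕ) : ℂ) + 1 = a + n + 1 + 1 by push_cast; ring,
      div_eq_mul_inv, div_eq_mul_inv, h]
    ring
  have hnorm := congrArg norm hrec
  rw [norm_mul, norm_mul] at hnorm
  have hx := norm_nonneg x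
  have hu := norm_nonneg (x ^ n / Complex.Gamma (a + n + 1))
  have hpos : 0 < ‖a + n + 1‖ := by linarith
  refine le_of_mul_le_mul_left ?_ hpos
  rw [hnorm]
  nlinarith

theorem millerRoss_tsum_eq_add (a x : ℂ) :
    ∑' n : ℕ, x ^ n / Complex.Gamma (a + n + 1) =
      (Complex.Gamma (a + 1))⁻¹ + x * ∑' n : ℕ, x ^ n / Complex.Gamma (a + 1 + n + 1) := by
  rw [(millerRoss_summable a x).tsum_eq_zero_add, ← tsum_mul_left]
  congr 1
  · simp
  · refine tsum_congr fun n => ?_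
    rw [show a + ((n + 1 : ℕ) : ℂ) + 1 = a + 1 + n + 1 by push_cast; ring]
    ring

/-- The two-term recurrence `E_{ν,c}(z) = z^ν / Γ(ν+1) + c E_{ν+1,c}(z)`. -/
theorem millerRoss_eq_add (ν c z : ℂ) (hz : z ≠ 0) :
    millerRoss ν c z = z ^ ν / Complex.Gamma (ν + 1) + c * millerRoss (ν + 1) c z := by
  rw [millerRoss, millerRoss, millerRoss_tsum_eq_add, Complex.cpow_add _ _ hz, Complex.cpow_one]
  ring

/-- Recurrence: `z² E_{ν,c}(z) = z^{ν+2}/Γ(ν+1) + c² z² E_{ν+2,c}(z)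
  + c(ν+2)(ν+3)(E_{ν+3,c}(z) − c E_{ν+4,c}(z))`. -/
theorem millerRoss_rec_iii (ν c z : ℂ) (hz : z ≠ 0) :
    z ^ 2 * millerRoss ν c z =
      z ^ (ν + 2) / Complex.Gamma (ν + 1) + c ^ 2 * z ^ 2 * millerRoss (ν + 2) c z +
        c * (ν + 2) * (ν + 3) *
          (millerRoss (ν + 3) c z - c * millerRoss (ν + 4) c z) := by
  have h0 := millerRoss_eq_add ν c z hz
  have h1 := millerRoss_eq_add (ν + 1) c z hz
  have h3 := millerRoss_eq_add (ν + 3) c z hz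
  have g2 := Complex.one_div_Gamma_eq_self_mul_one_div_Gamma_add_one (ν + 2)
  have g3 := Complex.one_div_Gamma_eq_self_mul_one_div_Gamma_add_one (ν + 3)
  rw [show ν + 1 + 1 = ν + 2 by ring] at h1
  rw [show ν + 3 + 1 = ν + 4 by ring] at h3 g3
  rw [show ν + 2 + 1 = ν + 3 by ring] at g2
  have p1 : z ^ (ν + 1) = z ^ ν * z := by rw [Complex.cpow_add _ _ hz, Complex.cpow_one]
  have p2 : z ^ (ν + 2) = z ^ ν * z ^ 2 := by
    rw [Complex.cpow_add _ _ hz, Complex.cpow_ofNat]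
  have p3 : z ^ (ν + 3) = z ^ ν * z ^ 3 := by
    rw [Complex.cpow_add _ _ hz, Complex.cpow_ofNat]
  rw [h0, h1, h3, p1, p2, p3]
  simp only [div_eq_mul_inv]
  rw [g2, g3]
  ring
end

section
/- Let ν, μ, c, z ∈ ℂ with Re(ν) > 0 and Re(μ) > 0. Then E_{ν+μ,c}(z) = ( z^{ν+μ} / (Γ(ν) Γ(μ)) ) · ∑_{r=0}^∞ ((c z)^r / r!) · ( ∫₀¹ s^{ν−1} (1−s)^{μ+r} ds ) · ( ∫₀¹ t^{μ−1} (1−t)^r dt ), where the integrals are over real s, t ∈ (0,1) and the powers of s, 1−s, t, 1−t are principal complex powers of positive reals. -/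
/-- The Beta integral with second exponent `v` in place of `v - 1`, as a quotient of Gamma values. -/
lemma integral_cpow_mul_one_sub_cpow {u v : ℂ} (hu : 0 < u.re) (hv : 0 < (v + 1).re) :
    ∫ x in (0:ℝ)..1, (x : ℂ) ^ (u - 1) * ((1 : ℂ) - (x : ℂ)) ^ v =
      Complex.Gamma u * Complex.Gamma (v + 1) / Complex.Gamma (u + v + 1) := by
  simpa [Complex.betaIntegral, add_assoc] using
    Complex.betaIntegral_eq_Gamma_mul_div u (v + 1) hu hv

/-- Double-integral representation (Theorem 3.3, component form): for `Re ν > 0`,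
`Re μ > 0`, `E_{ν+μ,c}(z) = (z^{ν+μ}/(Γ(ν)Γ(μ))) ∑_{r=0}^∞ ((cz)^r/r!)
  (∫₀¹ s^{ν−1}(1−s)^{μ+r} ds)(∫₀¹ t^{μ−1}(1−t)^r dt)`. -/
theorem millerRoss_double_integral_rep (ν μ c z : ℂ) (hν : 0 < ν.re) (hμ : 0 < μ.re) :
    millerRoss (ν + μ) c z =
      z ^ (ν + μ) / (Complex.Gamma ν * Complex.Gamma μ) *
        ∑' r : ℕ, (c * z) ^ r / (r.factorial : ℂ) *
          (∫ s in (0:ℝ)..1, (s : ℂ) ^ (ν - 1) * ((1 : ℂ) - (s : ℂ)) ^ (μ + (r : ℂ))) *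
          (∫ t in (0:ℝ)..1, (t : ℂ) ^ (μ - 1) * ((1 : ℂ) - (t : ℂ)) ^ (r : ℂ)) := by
  have hΓν := Complex.Gamma_ne_zero_of_re_pos hν
  have hΓμ := Complex.Gamma_ne_zero_of_re_pos hμ
  rw [millerRoss, div_mul_eq_mul_div, mul_div_assoc, ← tsum_div_const]
  congr 2
  ext r
  have hr : 0 < ((r : ℂ) + 1).re := by
    simp only [Complex.add_re, Complex.natCast_re, Complex.one_re]
    positivity
  have hμr : 0 < (μ + r + 1).re := by
    rw [add_assoc, Complex.add_re]
    exact add_pos hμ hr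
  have hΓμr := Complex.Gamma_ne_zero_of_re_pos hμr
  have hfact : (r.factorial : ℂ) ≠ 0 := Nat.cast_ne_zero.mpr r.factorial_ne_zero
  rw [integral_cpow_mul_one_sub_cpow hν hμr, integral_cpow_mul_one_sub_cpow hμ hr,
    Complex.Gamma_nat_eq_factorial, ← add_assoc ν μ]
  field_simp
end

section
/- Let ν, c ∈ ℂ and k ∈ ℕ. For every z ∈ ℂ lying off the nonpositive real axis (that is, Re(z) > 0 or Im(z) ≠ 0), the k-th complex derivative of the Miller-Ross function satisfies (d^k/dz^k) E_{ν,c}(z) = ∑_{p=1}^k c^{k−p} z^{ν−p} / Γ(ν−p+1) + c^k E_{ν,c}(z). -/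
/-- The power series in the Miller-Ross function is entire and satisfies a first-order
linear differential equation. -/
theorem exists_hasDerivAt_tsum_pow_div_Gamma (ν c z : ℂ) :
    ∃ S' : ℂ, HasDerivAt (fun w : ℂ => ∑' n : ℕ, (c * w) ^ n / Complex.Gamma (ν + n + 1)) S' z ∧
      ν * (∑' n : ℕ, (c * z) ^ n / Complex.Gamma (ν + n + 1)) + z * S' =
        1 / Complex.Gamma ν
          + c * z * ∑' n : ℕ, (c * z) ^ n / Complex.Gamma (ν + n + 1) := by
  set F : ℕ → ℂ → ℂ := fun n w => (c * w) ^ n / Complex.Gamma (ν + n + 1) with hF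
  have hFd : ∀ n w, HasDerivAt (F n)
      (n * (c * w) ^ (n - 1) * c / Complex.Gamma (ν + n + 1)) w := fun n w => by
    simpa using ((((hasDerivAt_id w).const_mul c).pow n).div_const (Complex.Gamma (ν + n + 1)))
  have hu : Summable fun n : ℕ =>
      ‖(c * ((‖z‖ + 1 : ℝ) : ℂ)) ^ n / Complex.Gamma (ν + n + 1)‖ :=
    (summable_pow_div_Gamma ν _).norm
  have hd : ∀ n, DifferentiableOn ℂ (F n) (Metric.ball 0 (‖z‖ + 1)) := fun n w _ =>
    (hFd n w).differentiableAt.differentiableWithinAt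
  have hle : ∀ n w, w ∈ Metric.ball (0 : ℂ) (‖z‖ + 1) →
      ‖F n w‖ ≤ ‖(c * ((‖z‖ + 1 : ℝ) : ℂ)) ^ n / Complex.Gamma (ν + n + 1)‖ := by
    intro n w hw
    have hw' : ‖w‖ ≤ |‖z‖ + 1| := (mem_ball_zero_iff.mp hw).le.trans (le_abs_self _)
    simp only [hF, norm_div, norm_pow, norm_mul, Complex.norm_real, Real.norm_eq_abs]
    gcongr
  have hzb : z ∈ Metric.ball (0 : ℂ) (‖z‖ + 1) := by simp
  have hdiff := (Complex.differentiableOn_tsum_of_summable_norm hu hd Metric.isOpen_ball hle)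
    |>.differentiableAt (Metric.isOpen_ball.mem_nhds hzb)
  have hsum := Complex.hasSum_deriv_of_summable_norm hu hd Metric.isOpen_ball hle hzb
  refine ⟨_, hdiff.hasDerivAt, ?_⟩
  have hS : HasSum (fun n => F n z) (∑' n, F n z) := (summable_pow_div_Gamma ν (c * z)).hasSum
  refine ((hS.mul_left ν).add (hsum.mul_left z)).unique ?_
  rw [← hasSum_nat_add_iff' 1]
  have h0 : ν * F 0 z + z * deriv (F 0) z = 1 / Complex.Gamma ν := by
    rw [(hFd 0 z).deriv, one_div, Complex.one_div_Gamma_eq_self_mul_one_div_Gamma_add_one]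
    simp [hF]
  rw [Finset.sum_range_one, h0, add_sub_cancel_left]
  refine (hS.mul_left (c * z)).congr_fun ?_
  intro n
  rw [(hFd (n + 1) z).deriv]
  have hrec := Complex.one_div_Gamma_eq_self_mul_one_div_Gamma_add_one (ν + n + 1)
  have e : ν + ((n + 1 : ℕ) : ℂ) + 1 = ν + n + 1 + 1 := by push_cast; ring
  simp only [hF, e, div_eq_mul_inv, hrec, Nat.add_sub_cancel, pow_succ]
  push_cast
  ring

/-- The Miller-Ross function satisfies `E' = z^{ν-1}/Γ(ν) + c E` on the slit plane. -/
theorem hasDerivAt_millerRoss (ν c : ℂ) {z : ℂ} (hz : z ∈ Complex.slitPlane) :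
    HasDerivAt (millerRoss ν c)
      (z ^ (ν - 1) / Complex.Gamma ν + c * millerRoss ν c z) z := by
  obtain ⟨S', hS', hode⟩ := exists_hasDerivAt_tsum_pow_div_Gamma ν c z
  have hz0 : z ≠ 0 := Complex.slitPlane_ne_zero hz
  have hpow : z ^ ν = z ^ (ν - 1) * z := by
    rw [Complex.cpow_sub _ _ hz0, Complex.cpow_one, div_mul_cancel₀ _ hz0]
  refine (((hasDerivAt_id z).cpow_const (c := ν) hz).mul hS').congr_deriv ?_
  simp only [millerRoss, id, hpow]
  linear_combination z ^ (ν - 1) * hode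

/-- The function `z ↦ z^s/Γ(s+1)` has derivative `z^{s-1}/Γ(s)`, also at the poles of `Γ`. -/
theorem hasDerivAt_cpow_div_Gamma (s : ℂ) {z : ℂ} (hz : z ∈ Complex.slitPlane) :
    HasDerivAt (fun w : ℂ => w ^ s / Complex.Gamma (s + 1))
      (z ^ (s - 1) / Complex.Gamma s) z := by
  refine (((hasDerivAt_id z).cpow_const (c := s) hz).div_const
    (Complex.Gamma (s + 1))).congr_deriv ?_
  rw [div_eq_mul_inv (z ^ (s - 1)), Complex.one_div_Gamma_eq_self_mul_one_div_Gamma_add_one]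
  simp only [id]
  ring

/-- Theorem 4.1, component form: on the slit plane (off the nonpositive real axis),
`(d^k/dz^k) E_{ν,c}(z) = ∑_{p=1}^k c^{k−p} z^{ν−p}/Γ(ν−p+1) + c^k E_{ν,c}(z)`. -/
theorem millerRoss_iteratedDeriv (ν c : ℂ) (k : ℕ) (z : ℂ)
    (hz : 0 < z.re ∨ z.im ≠ 0) :
    iteratedDeriv k (millerRoss ν c) z =
      (∑ p ∈ Finset.Icc 1 k, c ^ (k - p) * z ^ (ν - (p : ℂ)) / Complex.Gamma (ν - (p : ℂ) + 1))
        + c ^ k * millerRoss ν c z := by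
  induction k generalizing z with
  | zero => simp
  | succ k ih =>
    have hz' : z ∈ Complex.slitPlane := hz
    rw [iteratedDeriv_succ]
    have hev : iteratedDeriv k (millerRoss ν c) =ᶠ[nhds z] fun w =>
        (∑ p ∈ Finset.Icc 1 k,
          c ^ (k - p) * (w ^ (ν - (p : ℂ)) / Complex.Gamma (ν - (p : ℂ) + 1)))
          + c ^ k * millerRoss ν c w := by
      filter_upwards [Complex.isOpen_slitPlane.mem_nhds hz'] with w hw
      simp only [ih w hw, mul_div_assoc]
    have hder := (HasDerivAt.fun_sum fun p (_ : p ∈ Finset.Icc 1 k) =>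
      (hasDerivAt_cpow_div_Gamma (ν - (p : ℂ)) hz').const_mul (c ^ (k - p))).add
      ((hasDerivAt_millerRoss ν c hz').const_mul (c ^ k))
    rw [hev.deriv_eq]
    refine hder.deriv.trans ?_
    rw [← Finset.add_sum_Ioc_eq_sum_Icc (Nat.le_add_left 1 k)]
    have hshift : ∑ p ∈ Finset.Ioc 1 (k + 1),
        c ^ (k + 1 - p) * z ^ (ν - (p : ℂ)) / Complex.Gamma (ν - (p : ℂ) + 1) =
        ∑ p ∈ Finset.Icc 1 k,
          c ^ (k - p) * (z ^ (ν - (p : ℂ) - 1) / Complex.Gamma (ν - (p : ℂ))) := by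
      symm
      refine Finset.sum_bij (fun p _ => p + 1) ?_ ?_ ?_ ?_
      · intro p hp
        simp only [Finset.mem_Icc, Finset.mem_Ioc] at hp ⊢
        omega
      · intro p _ q _ h
        omega
      · intro q hq
        simp only [Finset.mem_Ioc] at hq
        exact ⟨q - 1, by simp only [Finset.mem_Icc]; omega, by omega⟩
      · intro p _
        have e : ν - ((p + 1 : ℕ) : ℂ) = ν - p - 1 := by push_cast; ring
        rw [e, sub_add_cancel, Nat.add_sub_add_right, mul_div_assoc]
    rw [hshift]
    simp only [Nat.cast_one, sub_add_cancel, Nat.add_sub_cancel]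
    ring
end

section
/- For all ν, c ∈ ℂ, every k ∈ ℕ, and every z ∈ ℂ with z ≠ 0: E_{ν−k,c}(z) = ∑_{p=1}^k c^{k−p} z^{ν−p} / Γ(ν−p+1) + c^k E_{ν,c}(z). -/
/-- Lowering the order of the Miller-Ross function by one. -/
theorem millerRoss_sub_one (ν c z : ℂ) (hz : z ≠ 0) :
    millerRoss (ν - 1) c z = z ^ (ν - 1) / Complex.Gamma ν + c * millerRoss ν c z := by
  have hshift (n : ℕ) : (c * z) ^ (n + 1) / Complex.Gamma (ν - 1 + (n + 1 : ℕ) + 1)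
      = c * z * ((c * z) ^ n / Complex.Gamma (ν + n + 1)) := by
    rw [show ν - 1 + ((n + 1 : ℕ) : ℂ) + 1 = ν + n + 1 by push_cast; ring]
    ring
  have hpow : z ^ ν = z ^ (ν - 1) * z := by
    rw [Complex.cpow_sub _ _ hz, Complex.cpow_one, div_mul_cancel₀ _ hz]
  unfold millerRoss
  rw [(summable_pow_div_Gamma (ν - 1) (c * z)).tsum_eq_zero_add]
  simp only [hshift]
  rw [tsum_mul_left, hpow, Nat.cast_zero, add_zero, sub_add_cancel, pow_zero]
  ring

/-- Remark after Theorem 4.2, component form: for `z ≠ 0`,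
`E_{ν−k,c}(z) = ∑_{p=1}^k c^{k−p} z^{ν−p}/Γ(ν−p+1) + c^k E_{ν,c}(z)`. -/
theorem millerRoss_order_shift_down (ν c : ℂ) (k : ℕ) (z : ℂ) (hz : z ≠ 0) :
    millerRoss (ν - (k : ℂ)) c z =
      (∑ p ∈ Finset.Icc 1 k, c ^ (k - p) * z ^ (ν - (p : ℂ)) / Complex.Gamma (ν - (p : ℂ) + 1))
        + c ^ k * millerRoss ν c z := by
  induction k with
  | zero => simp
  | succ k ih =>
    rw [show ν - ((k + 1 : ℕ) : ℂ) = ν - k - 1 by push_cast; ring, millerRoss_sub_one _ _ _ hz, ih,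
      Finset.sum_Icc_succ_top (by omega), mul_add, Finset.mul_sum]
    have hsum : ∑ p ∈ Finset.Icc 1 k,
          c * (c ^ (k - p) * z ^ (ν - (p : ℂ)) / Complex.Gamma (ν - (p : ℂ) + 1))
        = ∑ p ∈ Finset.Icc 1 k,
          c ^ (k + 1 - p) * z ^ (ν - (p : ℂ)) / Complex.Gamma (ν - (p : ℂ) + 1) := by
      refine Finset.sum_congr rfl fun p hp => ?_
      rw [Nat.succ_sub (Finset.mem_Icc.mp hp).2, pow_succ]
      ring
    rw [hsum, show ν - ((k + 1 : ℕ) : ℂ) = ν - k - 1 by push_cast; ring, sub_add_cancel,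
      Nat.sub_self, pow_zero]
    ring
end

section
/- Fix c ∈ ℂ and z ∈ ℂ with z ≠ 0. Then the function ν ↦ E_{ν,c}(z) = z^ν · ∑_{n=0}^∞ (c z)^n / Γ(ν+n+1) is analytic (complex differentiable) at every point ν ∈ ℂ, i.e. it is an entire function of the order ν. -/
theorem differentiable_pow_div_Gamma (a : ℂ) (n : ℕ) :
    Differentiable ℂ fun w : ℂ => a ^ n / Complex.Gamma (w + n + 1) := by
  simp only [div_eq_mul_inv]
  exact (Complex.differentiable_one_div_Gamma.comp
    (f := fun w : ℂ => w + n + 1) (by fun_prop)).const_mul _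

theorem mul_pow_succ_div_Gamma (a w : ℂ) (n : ℕ) :
    (w + n + 1) * (a ^ (n + 1) / Complex.Gamma (w + (n + 1 : ℕ) + 1)) =
      a * (a ^ n / Complex.Gamma (w + n + 1)) := by
  have h := Complex.one_div_Gamma_eq_self_mul_one_div_Gamma_add_one (w + n + 1)
  rw [div_eq_mul_inv, div_eq_mul_inv, h]
  push_cast
  ring_nf

/-- Eventually in `n`, the terms `a ^ n / Γ(w + n + 1)` at least halve in norm at each step,
uniformly for `w` in a bounded set. -/
theorem eventually_norm_pow_succ_div_Gamma_le (a : ℂ) (R : ℝ) :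
    ∀ᶠ n : ℕ in Filter.atTop, ∀ w : ℂ, ‖w‖ ≤ R →
      ‖a ^ (n + 1) / Complex.Gamma (w + (n + 1 : ℕ) + 1)‖ ≤
        1 / 2 * ‖a ^ n / Complex.Gamma (w + n + 1)‖ := by
  filter_upwards [Filter.eventually_ge_atTop ⌈R + 2 * ‖a‖⌉₊] with n hn w hw
  have hn' : R + 2 * ‖a‖ ≤ n := Nat.ceil_le.mp hn
  have hlow : 2 * ‖a‖ + 1 ≤ ‖w + n + 1‖ := by
    have h1 : ‖((n + 1 : ℕ) : ℂ)‖ ≤ ‖w + n + 1‖ + ‖w‖ := by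
      calc ‖((n + 1 : ℕ) : ℂ)‖ = ‖(w + n + 1) - w‖ := by push_cast; ring_nf
        _ ≤ _ := norm_sub_le _ _
    rw [Complex.norm_natCast] at h1
    push_cast at h1
    linarith
  have h := congrArg norm (mul_pow_succ_div_Gamma a w n)
  rw [norm_mul, norm_mul] at h
  set p := ‖a ^ (n + 1) / Complex.Gamma (w + (n + 1 : ℕ) + 1)‖
  set q := ‖a ^ n / Complex.Gamma (w + n + 1)‖
  have hp : 0 ≤ p := norm_nonneg _
  have hq : 0 ≤ q := norm_nonneg _
  have ha : 0 ≤ ‖a‖ := norm_nonneg _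
  have hle : (2 * ‖a‖ + 1) * p ≤ (2 * ‖a‖ + 1) * (1 / 2 * q) := by
    calc (2 * ‖a‖ + 1) * p ≤ ‖w + n + 1‖ * p := by gcongr
      _ = ‖a‖ * q := h
      _ ≤ (2 * ‖a‖ + 1) * (1 / 2 * q) := by linarith
  exact le_of_mul_le_mul_left hle (by linarith)

theorem differentiable_tsum_pow_div_Gamma (a : ℂ) :
    Differentiable ℂ fun w : ℂ => ∑' n : ℕ, a ^ n / Complex.Gamma (w + n + 1) := by
  intro ν
  have hmax (n : ℕ) : ∃ x ∈ Metric.closedBall (0 : ℂ) (‖ν‖ + 1),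
      IsMaxOn (fun w : ℂ => ‖a ^ n / Complex.Gamma (w + n + 1)‖)
        (Metric.closedBall 0 (‖ν‖ + 1)) x :=
    (isCompact_closedBall _ _).exists_isMaxOn
      (Metric.nonempty_closedBall.mpr (by positivity))
      (differentiable_pow_div_Gamma a n).continuous.norm.continuousOn
  choose x hx hxmax using hmax
  have hsum : Summable fun n : ℕ => ‖a ^ n / Complex.Gamma (x n + n + 1)‖ := by
    refine summable_of_ratio_norm_eventually_le (r := 1 / 2) (by norm_num) ?_
    filter_upwards [eventually_norm_pow_succ_div_Gamma_le a (‖ν‖ + 1)] with n hn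
    rw [norm_norm, norm_norm]
    refine (hn _ (mem_closedBall_zero_iff.mp (hx (n + 1)))).trans ?_
    gcongr 1 / 2 * ?_
    exact hxmax n (hx (n + 1))
  refine (Complex.differentiableOn_tsum_of_summable_norm hsum
    (fun n => (differentiable_pow_div_Gamma a n).differentiableOn)
    (Metric.isOpen_ball (x := (0 : ℂ)) (ε := ‖ν‖ + 1))
    fun n w hw => hxmax n (Metric.ball_subset_closedBall hw)).differentiableAt ?_
  exact Metric.isOpen_ball.mem_nhds (by simp)

/-- Theorem 5.1, component form: for fixed `c` and fixed `z ≠ 0`, the Miller-Ross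
function is an entire (everywhere complex differentiable) function of the order `ν`. -/
theorem millerRoss_differentiable_order (c z : ℂ) (hz : z ≠ 0) (ν : ℂ) :
    DifferentiableAt ℂ (fun w : ℂ => millerRoss w c z) ν := by
  unfold millerRoss
  exact (differentiableAt_id.const_cpow (Or.inl hz)).mul
    (differentiable_tsum_pow_div_Gamma (c * z) ν)
end

section
/- Let l ∈ ℕ and c ∈ ℂ. Then the function z ↦ E_{l,c}(z) = z^l · ∑_{n=0}^∞ (c z)^n / Γ(l+n+1) is analytic (complex differentiable) at every point z ∈ ℂ, i.e. E_{l,c} is an entire function of z. -/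
theorem norm_pow_div_Gamma_nat_add_le (l n : ℕ) {w : ℂ} {r : ℝ} (hw : ‖w‖ ≤ r) :
    ‖w ^ n / Complex.Gamma ((l : ℂ) + n + 1)‖ ≤ r ^ n / n.factorial := by
  have hr : 0 ≤ r := (norm_nonneg w).trans hw
  have hΓ : Complex.Gamma ((l : ℂ) + n + 1) = ((l + n).factorial : ℂ) := by
    exact_mod_cast Complex.Gamma_nat_eq_factorial (l + n)
  rw [hΓ, norm_div, norm_pow, Complex.norm_natCast]
  gcongr
  omega

theorem differentiable_tsum_pow_div_Gamma_nat_add (l : ℕ) :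
    Differentiable ℂ fun w : ℂ => ∑' n : ℕ, w ^ n / Complex.Gamma ((l : ℂ) + n + 1) := by
  intro w
  have hU : IsOpen (Metric.ball (0 : ℂ) (‖w‖ + 1)) := Metric.isOpen_ball
  refine (Complex.differentiableOn_tsum_of_summable_norm
    (Real.summable_pow_div_factorial (‖w‖ + 1)) (fun n => by fun_prop) hU
    fun n v hv => norm_pow_div_Gamma_nat_add_le l n (mem_ball_zero_iff.mp hv).le).differentiableAt
    (hU.mem_nhds ?_)
  simp

/-- Theorem 5.3, component form: for a natural-number order `l`, the Miller-Ross
function `E_{l,c}` is an entire function of `z`. -/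
theorem millerRoss_entire_nat_order (l : ℕ) (c : ℂ) (z : ℂ) :
    DifferentiableAt ℂ (millerRoss (l : ℂ) c) z := by
  unfold millerRoss
  simp only [Complex.cpow_natCast]
  exact (differentiableAt_id.pow l).mul
    ((differentiable_tsum_pow_div_Gamma_nat_add l).comp (differentiable_id.const_mul c) z)
end

section
/- Let μ, ν, c ∈ ℂ with Re(μ) > 0 and Re(ν) > −1, let z₀ ∈ ℂ with z₀ ≠ 0, and let t > 0 be real. Then the Riemann–Liouville fractional integral of order μ of s ↦ E_{ν,c}(z₀ s) satisfies (1/Γ(μ)) · ∫₀^t (t−s)^{μ−1} E_{ν,c}(z₀ s) ds = z₀^{−μ} · E_{ν+μ,c}(z₀ t), where (t−s)^{μ−1} is the principal complex power of the positive real t−s, z₀^{−μ} is the principal complex power, and the integral is over real s ∈ (0,t). -/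
theorem Complex.mul_ofReal_cpow {z : ℂ} (hz : z ≠ 0) {r : ℝ} (hr : 0 < r) (w : ℂ) :
    (z * r) ^ w = z ^ w * (r : ℂ) ^ w := by
  have hr' : (r : ℂ) ≠ 0 := Complex.ofReal_ne_zero.mpr hr.ne'
  rw [Complex.cpow_def_of_ne_zero (mul_ne_zero hz hr'), Complex.cpow_def_of_ne_zero hz,
    Complex.cpow_def_of_ne_zero hr', Complex.log_mul_ofReal r hr z hz, Complex.ofReal_log hr.le,
    ← Complex.exp_add]
  ring_nf

open Filter in
theorem summable_norm_pow_div_Gamma {ν : ℂ} (hν : -1 < ν.re) (x : ℂ) :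
    Summable fun n : ℕ => ‖x ^ n / Complex.Gamma (ν + n + 1)‖ := by
  refine summable_of_ratio_norm_eventually_le (r := 1 / 2) (by norm_num) ?_
  filter_upwards [eventually_ge_atTop ⌈2 * ‖x‖ - ν.re - 1⌉₊] with n hn
  have hn' : 2 * ‖x‖ - ν.re - 1 ≤ n := Nat.ceil_le.mp hn
  have hre : (ν + n + 1).re = ν.re + n + 1 := by simp
  have hpos : 0 < (ν + n + 1).re := by
    rw [hre]; linarith [Nat.cast_nonneg (α := ℝ) n]
  have h0 : ν + n + 1 ≠ 0 := fun h => by simp [h] at hpos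
  have hle : 2 * ‖x‖ ≤ ‖ν + n + 1‖ := by
    refine le_trans ?_ (Complex.re_le_norm _)
    rw [hre]; linarith
  have hΓ : Complex.Gamma (ν + (n + 1 : ℕ) + 1)
      = (ν + n + 1) * Complex.Gamma (ν + n + 1) := by
    rw [← Complex.Gamma_add_one _ h0]
    push_cast
    ring_nf
  have hstep : x ^ (n + 1) / Complex.Gamma (ν + (n + 1 : ℕ) + 1)
      = x / (ν + n + 1) * (x ^ n / Complex.Gamma (ν + n + 1)) := by
    rw [hΓ, pow_succ', mul_div_mul_comm]
  rw [norm_norm, norm_norm, hstep, norm_mul, norm_div]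
  refine mul_le_mul_of_nonneg_right ?_ (norm_nonneg _)
  rw [div_le_iff₀ (norm_pos_iff.mpr h0)]
  linarith

open MeasureTheory in
theorem intervalIntegrable_cpow_mul_sub_cpow {u v : ℂ} (hu : 0 < u.re) (hv : 0 < v.re)
    {t : ℝ} (ht : 0 < t) :
    IntervalIntegrable (fun s : ℝ => ((s : ℂ)) ^ (u - 1) * ((t : ℂ) - s) ^ (v - 1))
      volume 0 t := by
  have ht' : (t : ℂ) ≠ 0 := Complex.ofReal_ne_zero.mpr ht.ne'
  have h := ((Complex.betaIntegral_convergent hu hv).comp_mul_left (c := t⁻¹)).const_mul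
    ((t : ℂ) ^ (u - 1) * (t : ℂ) ^ (v - 1))
  rw [zero_div, one_div, inv_inv] at h
  refine h.congr_uIoo fun s hs => ?_
  rw [Set.uIoo_of_le ht.le] at hs
  have hs1 : 0 ≤ t⁻¹ * s := mul_nonneg (inv_nonneg.mpr ht.le) hs.1.le
  have hs2 : 0 ≤ 1 - t⁻¹ * s := by
    rw [sub_nonneg, inv_mul_le_iff₀ ht]
    linarith [hs.2]
  have e1 : (s : ℂ) = (t : ℂ) * ((t⁻¹ * s : ℝ) : ℂ) := by
    push_cast; field_simp
  have e2 : (t : ℂ) - s = (t : ℂ) * ((1 - t⁻¹ * s : ℝ) : ℂ) := by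
    push_cast; field_simp
  rw [e2, Complex.mul_cpow_ofReal_nonneg ht.le hs2]
  conv_rhs => rw [e1, Complex.mul_cpow_ofReal_nonneg ht.le hs1]
  push_cast
  ring

open MeasureTheory in
/-- The Riemann–Liouville integral of the power `s ^ u`, without the factor `1 / Γ(μ)`. -/
theorem integral_sub_cpow_mul_cpow {μ u : ℂ} (hμ : 0 < μ.re) (hu : -1 < u.re)
    {t : ℝ} (ht : 0 < t) :
    ∫ s in (0:ℝ)..t, ((t - s : ℝ) : ℂ) ^ (μ - 1) * (s : ℂ) ^ u =
      Complex.Gamma μ * Complex.Gamma (u + 1) / Complex.Gamma (u + μ + 1) * (t : ℂ) ^ (u + μ) := by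
  have hu' : 0 < (u + 1).re := by simp; linarith
  have h := Complex.betaIntegral_scaled (u + 1) μ ht
  rw [Complex.betaIntegral_eq_Gamma_mul_div _ _ hu' hμ, add_sub_cancel_right,
    show u + 1 + μ - 1 = u + μ by ring, show u + 1 + μ = u + μ + 1 by ring] at h
  simp_rw [Complex.ofReal_sub, mul_comm (_ ^ (μ - 1))]
  rw [h]
  ring

open MeasureTheory intervalIntegral in
/-- The key computation in Theorem 7.3 (component form): the Riemann–Liouville
fractional integral of order `μ` of `s ↦ E_{ν,c}(z₀ s)` is
`D_t^{−μ} E_{ν,c}(z₀ t) = z₀^{−μ} E_{ν+μ,c}(z₀ t)`. -/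
theorem millerRoss_RL_fractional_integral (μ ν c : ℂ) (hμ : 0 < μ.re) (hν : -1 < ν.re)
    (z₀ : ℂ) (hz : z₀ ≠ 0) (t : ℝ) (ht : 0 < t) :
    (1 / Complex.Gamma μ) *
        (∫ s in (0:ℝ)..t, ((t - s : ℝ) : ℂ) ^ (μ - 1) * millerRoss ν c (z₀ * (s : ℂ))) =
      z₀ ^ (-μ) * millerRoss (ν + μ) c (z₀ * (t : ℂ)) := by
  have ht' : (t : ℂ) ≠ 0 := Complex.ofReal_ne_zero.mpr ht.ne'
  have hΓμ : Complex.Gamma μ ≠ 0 := Complex.Gamma_ne_zero_of_re_pos hμ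
  have hνn : ∀ n : ℕ, -1 < (ν + n).re := fun n => by
    simp only [Complex.add_re, Complex.natCast_re]
    linarith [Nat.cast_nonneg (α := ℝ) n]
  have hΓν : ∀ n : ℕ, Complex.Gamma (ν + n + 1) ≠ 0 := fun n =>
    Complex.Gamma_ne_zero_of_re_pos (by
      rw [Complex.add_re, Complex.one_re]
      linarith [hνn n])
  have hK : IntervalIntegrable
      (fun s : ℝ => ((t - s : ℝ) : ℂ) ^ (μ - 1) * (s : ℂ) ^ ν) volume 0 t := by
    have h := intervalIntegrable_cpow_mul_sub_cpow (u := ν + 1) (v := μ)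
      (by simp; linarith) hμ ht
    simpa only [add_sub_cancel_right, Complex.ofReal_sub, mul_comm] using h
  have hsum := hasSum_integral_of_dominated_convergence (μ := volume) (a := 0) (b := t)
    (F := fun (n : ℕ) (s : ℝ) => ((t - s : ℝ) : ℂ) ^ (μ - 1) * (s : ℂ) ^ ν *
      (z₀ ^ ν * ((c * (z₀ * s)) ^ n / Complex.Gamma (ν + n + 1))))
    (f := fun s : ℝ => ((t - s : ℝ) : ℂ) ^ (μ - 1) * millerRoss ν c (z₀ * (s : ℂ)))
    (fun n s => ‖((t - s : ℝ) : ℂ) ^ (μ - 1) * (s : ℂ) ^ ν‖ *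
      (‖z₀ ^ ν‖ * ‖(c * (z₀ * t)) ^ n / Complex.Gamma (ν + n + 1)‖))
    (fun n => (hK.mul_continuousOn (by fun_prop)).aestronglyMeasurable_restrict_uIoc)
    (fun n => .of_forall fun s hs => by
      rw [Set.uIoc_of_le ht.le] at hs
      simp only [norm_mul, norm_div, norm_pow, Complex.norm_real, Real.norm_eq_abs,
        abs_of_pos hs.1, abs_of_pos ht]
      have h0 := hs.1.le
      gcongr
      exact hs.2)
    (.of_forall fun s _ => ((summable_norm_pow_div_Gamma hν _).mul_left _).mul_left _)
    (by
      simp only [tsum_mul_left]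
      exact hK.norm.mul_const _)
    (.of_forall fun s hs => by
      rw [Set.uIoc_of_le ht.le] at hs
      rw [millerRoss, Complex.mul_ofReal_cpow hz hs.1, mul_comm (z₀ ^ ν),
        mul_assoc ((s : ℂ) ^ ν), ← mul_assoc (_ ^ (μ - 1))]
      exact ((summable_norm_pow_div_Gamma hν _).of_norm.hasSum.mul_left _).mul_left _)
  rw [← hsum.tsum_eq, millerRoss, ← tsum_mul_left, ← tsum_mul_left, ← tsum_mul_left]
  refine tsum_congr fun n => ?_
  have hterm : ∀ s ∈ Set.uIoo 0 t, ((t - s : ℝ) : ℂ) ^ (μ - 1) * (s : ℂ) ^ ν *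
      (z₀ ^ ν * ((c * (z₀ * s)) ^ n / Complex.Gamma (ν + n + 1))) =
      (z₀ ^ ν * (c * z₀) ^ n / Complex.Gamma (ν + n + 1)) *
        (((t - s : ℝ) : ℂ) ^ (μ - 1) * (s : ℂ) ^ (ν + n)) := fun s hs => by
    rw [Set.uIoo_of_le ht.le] at hs
    rw [Complex.cpow_add _ _ (Complex.ofReal_ne_zero.mpr hs.1.ne'), Complex.cpow_natCast,
      ← mul_assoc c, mul_pow _ (s : ℂ)]
    ring
  rw [integral_congr_uIoo hterm, intervalIntegral.integral_const_mul,
    integral_sub_cpow_mul_cpow hμ (hνn n) ht, Complex.mul_ofReal_cpow hz ht,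
    show ν + n + μ = ν + μ + n by ring, Complex.cpow_add (ν + μ) n ht', Complex.cpow_natCast,
    Complex.cpow_add ν μ hz, Complex.cpow_neg, ← mul_assoc c, mul_pow _ (t : ℂ)]
  have hz' : z₀ ^ μ ≠ 0 := by simp [Complex.cpow_eq_zero_iff, hz]
  have := hΓν n
  field_simp
end

section
/- Let c > 0 be a real number, let ν ∈ ℂ with Re(ν) > 0, let a ∈ ℂ, and let N₀ ∈ ℂ. Define N : (0,∞) → ℂ by N(t) = N₀ · ∑_{k=0}^∞ (−c^ν)^k · E_{νk,a}(t), where E_{νk,a}(t) = t^{νk} ∑_{n=0}^∞ (a t)^n / Γ(νk+n+1) with t^{νk} the principal complex power of the positive real t. Then for every t > 0, N satisfies N(t) − N₀ · exp(a t) = −c^ν · (1/Γ(ν)) · ∫₀^t (t−s)^{ν−1} N(s) ds, where (t−s)^{ν−1} and c^ν are principal complex powers of positive reals and the integral is over real s ∈ (0,t). -/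
/-- The Abel kernel `(t - s)^(ν-1)` is integrable on `[0, t]`. -/
theorem intervalIntegrable_abel_kernel {ν : ℂ} (hν : 0 < ν.re) (t : ℝ) :
    IntervalIntegrable (fun s : ℝ => ((t - s : ℝ) : ℂ) ^ (ν - 1)) MeasureTheory.volume 0 t := by
  have h : IntervalIntegrable (fun s : ℝ => (s : ℂ) ^ (ν - 1)) MeasureTheory.volume 0 t :=
    intervalIntegral.intervalIntegrable_cpow' (by simpa using hν)
  simpa using (h.comp_sub_left t).symm

/-- A real Beta-type integral dominating `betaIntegral u ν` for `x ≤ re u - 1`. -/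
noncomputable def betaMajorant (ν : ℂ) (x : ℝ) : ℝ :=
  ∫ s in (0 : ℝ)..1, s ^ x * ‖((1 - s : ℝ) : ℂ) ^ (ν - 1)‖

theorem betaMajorant_nonneg (ν : ℂ) (x : ℝ) : 0 ≤ betaMajorant ν x :=
  intervalIntegral.integral_nonneg zero_le_one fun _ hs =>
    mul_nonneg (Real.rpow_nonneg hs.1 x) (norm_nonneg _)

theorem norm_betaIntegral_le_betaMajorant {u ν : ℂ} (hν : 0 < ν.re) {x : ℝ} (hx : 0 ≤ x)
    (hxu : x ≤ u.re - 1) : ‖Complex.betaIntegral u ν‖ ≤ betaMajorant ν x := by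
  refine intervalIntegral.norm_integral_le_of_norm_le zero_le_one (.of_forall fun s hs => ?_) ?_
  · rw [norm_mul, Complex.norm_cpow_eq_rpow_re_of_pos hs.1]
    push_cast
    gcongr ?_ * _
    exact Real.rpow_le_rpow_of_exponent_ge hs.1 hs.2 (by simpa using hxu)
  · exact (intervalIntegrable_abel_kernel hν 1).norm.continuousOn_mul
      (Real.continuous_rpow_const hx).continuousOn

open Filter Topology in
theorem tendsto_betaMajorant_atTop {ν : ℂ} (hν : 0 < ν.re) :
    Tendsto (betaMajorant ν) atTop (𝓝 0) := by
  have h := intervalIntegral.tendsto_integral_filter_of_dominated_convergence (l := atTop)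
    (μ := MeasureTheory.volume) (a := 0) (b := 1)
    (F := fun (x : ℝ) (s : ℝ) => s ^ x * ‖((1 - s : ℝ) : ℂ) ^ (ν - 1)‖) (f := fun _ => (0 : ℝ))
    (fun s => ‖((1 - s : ℝ) : ℂ) ^ (ν - 1)‖) ?_ ?_ (intervalIntegrable_abel_kernel hν 1).norm ?_
  · rwa [intervalIntegral.integral_zero] at h
  · exact .of_forall fun x => Measurable.aestronglyMeasurable (by fun_prop)
  · filter_upwards [eventually_ge_atTop 0] with x hx
    refine .of_forall fun s hs => ?_
    rw [Set.uIoc_of_le zero_le_one] at hs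
    rw [norm_mul, norm_norm, Real.norm_of_nonneg (Real.rpow_nonneg hs.1.le x)]
    exact mul_le_of_le_one_left (norm_nonneg _) (Real.rpow_le_one hs.1.le hs.2 hx)
  · filter_upwards [MeasureTheory.Measure.ae_ne MeasureTheory.volume (1 : ℝ)] with s hs1 hs
    rw [Set.uIoc_of_le zero_le_one] at hs
    simpa using (tendsto_rpow_atTop_of_base_lt_one s (by linarith [hs.1])
      (lt_of_le_of_ne hs.2 hs1)).mul_const ‖((1 - s : ℝ) : ℂ) ^ (ν - 1)‖

/-- Inductive majorant of `n! / |Γ(ν k + n + 1)|`, uniform in `n`. -/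
noncomputable def invGammaMajorant (ν : ℂ) (k : ℕ) : ℝ :=
  ∏ j ∈ Finset.range k, betaMajorant ν (ν.re * j) / ‖Complex.Gamma ν‖

theorem invGammaMajorant_nonneg (ν : ℂ) (k : ℕ) : 0 ≤ invGammaMajorant ν k :=
  Finset.prod_nonneg fun _ _ => div_nonneg (betaMajorant_nonneg _ _) (norm_nonneg _)

theorem re_mul_natCast_add_natCast_add_one_pos {ν : ℂ} (hν : 0 < ν.re) (k n : ℕ) :
    0 < (ν * k + n + 1).re := by
  simp only [Complex.add_re, Complex.mul_re, Complex.natCast_re, Complex.natCast_im, mul_zero,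
    sub_zero, Complex.one_re]
  positivity

theorem norm_inv_Gamma_le_invGammaMajorant {ν : ℂ} (hν : 0 < ν.re) (k n : ℕ) :
    ‖(Complex.Gamma (ν * k + n + 1))⁻¹‖ ≤ invGammaMajorant ν k * (n.factorial : ℝ)⁻¹ := by
  induction k with
  | zero => simp [invGammaMajorant, Complex.Gamma_nat_eq_factorial]
  | succ k ih =>
    have hu := re_mul_natCast_add_natCast_add_one_pos hν k n
    have hβ : ‖Complex.betaIntegral (ν * k + n + 1) ν‖ ≤ betaMajorant ν (ν.re * k) :=
      norm_betaIntegral_le_betaMajorant hν (by positivity) (by simp)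
    have hΓu := Complex.Gamma_ne_zero_of_re_pos hu
    have hΓν := Complex.Gamma_ne_zero_of_re_pos hν
    have key : (Complex.Gamma (ν * (k + 1 : ℕ) + n + 1))⁻¹ =
        Complex.betaIntegral (ν * k + n + 1) ν / Complex.Gamma ν *
          (Complex.Gamma (ν * k + n + 1))⁻¹ := by
      rw [Complex.betaIntegral_eq_Gamma_mul_div _ _ hu hν,
        show ν * (k + 1 : ℕ) + n + 1 = ν * k + n + 1 + ν by push_cast; ring]
      field_simp
    rw [key, norm_mul, norm_div, invGammaMajorant, Finset.prod_range_succ, ← invGammaMajorant,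
      mul_comm (invGammaMajorant ν k), mul_assoc]
    have := betaMajorant_nonneg ν (ν.re * k)
    gcongr

open Filter Topology in
theorem summable_pow_mul_invGammaMajorant {ν : ℂ} (hν : 0 < ν.re) (x : ℝ) :
    Summable fun k => x ^ k * invGammaMajorant ν k := by
  have h : Tendsto (fun k : ℕ => |x| * (betaMajorant ν (ν.re * k) / ‖Complex.Gamma ν‖)) atTop
      (𝓝 0) := by
    simpa using (((tendsto_betaMajorant_atTop hν).comp
      (tendsto_natCast_atTop_atTop.const_mul_atTop hν)).div_const ‖Complex.Gamma ν‖).const_mul |x|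
  refine summable_of_ratio_norm_eventually_le (r := 1 / 2) (by norm_num) ?_
  filter_upwards [h.eventually_le_const (by norm_num : (0 : ℝ) < 1 / 2)] with k hk
  have e : ‖x ^ (k + 1) * invGammaMajorant ν (k + 1)‖ =
      |x| * (betaMajorant ν (ν.re * k) / ‖Complex.Gamma ν‖) *
        ‖x ^ k * invGammaMajorant ν k‖ := by
    rw [invGammaMajorant, Finset.prod_range_succ, ← invGammaMajorant]
    simp only [norm_mul, norm_div, norm_pow, Real.norm_eq_abs,
      abs_of_nonneg (betaMajorant_nonneg ν _), abs_norm]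
    ring
  rw [e]
  gcongr

/-- The terms of the double series `∑ k, l ^ k * E_{νk,a}(t)`. -/
noncomputable def millerRossTerm (l ν a : ℂ) (p : ℕ × ℕ) (t : ℝ) : ℂ :=
  l ^ p.1 * ((t : ℂ) ^ (ν * p.1) * ((a * t) ^ p.2 / Complex.Gamma (ν * p.1 + p.2 + 1)))

/-- A majorant on `(0, t]` of the terms of the double series. -/
noncomputable def millerRossMajorant (l ν a : ℂ) (t : ℝ) (p : ℕ × ℕ) : ℝ :=
  ((‖l‖ * t ^ ν.re) ^ p.1 * invGammaMajorant ν p.1) * ((‖a‖ * t) ^ p.2 / p.2.factorial)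

theorem summable_millerRossMajorant (l : ℂ) {ν : ℂ} (hν : 0 < ν.re) (a : ℂ) {t : ℝ}
    (ht : 0 ≤ t) : Summable (millerRossMajorant l ν a t) :=
  (summable_pow_mul_invGammaMajorant hν _).mul_of_nonneg
    (Real.summable_pow_div_factorial (‖a‖ * t))
    (fun k => mul_nonneg (by positivity) (invGammaMajorant_nonneg ν k))
    (fun n => by simp only [Pi.zero_apply]; positivity)

theorem norm_millerRossTerm_le (l : ℂ) {ν : ℂ} (hν : 0 < ν.re) (a : ℂ) {s t : ℝ} (hs : 0 < s)
    (hst : s ≤ t) (p : ℕ × ℕ) : ‖millerRossTerm l ν a p s‖ ≤ millerRossMajorant l ν a t p := by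
  obtain ⟨k, n⟩ := p
  have hΓ := norm_inv_Gamma_le_invGammaMajorant hν k n
  have hpow : ‖(s : ℂ) ^ (ν * k)‖ ≤ (t ^ ν.re) ^ k := by
    rw [Complex.norm_cpow_eq_rpow_re_of_pos hs, ← Real.rpow_mul_natCast (hs.le.trans hst)]
    simp only [Complex.mul_re, Complex.natCast_re, Complex.natCast_im, mul_zero, sub_zero]
    gcongr
  have hq := invGammaMajorant_nonneg ν k
  calc ‖millerRossTerm l ν a (k, n) s‖
      = ‖l‖ ^ k * (‖(s : ℂ) ^ (ν * k)‖ *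
          ((‖a‖ * s) ^ n * ‖(Complex.Gamma (ν * k + n + 1))⁻¹‖)) := by
        simp [millerRossTerm, div_eq_mul_inv, abs_of_pos hs]
    _ ≤ ‖l‖ ^ k * ((t ^ ν.re) ^ k *
          ((‖a‖ * t) ^ n * (invGammaMajorant ν k * (n.factorial : ℝ)⁻¹))) := by
        have : 0 ≤ t := hs.le.trans hst
        gcongr
    _ = millerRossMajorant l ν a t (k, n) := by
        simp only [millerRossMajorant, mul_pow, div_eq_mul_inv]
        ring

theorem summable_millerRossTerm (l : ℂ) {ν : ℂ} (hν : 0 < ν.re) (a : ℂ) {t : ℝ} (ht : 0 < t) :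
    Summable fun p => millerRossTerm l ν a p t :=
  .of_norm_bounded (summable_millerRossMajorant l hν a ht.le)
    (norm_millerRossTerm_le l hν a ht le_rfl)

theorem tsum_millerRossTerm_mk (l ν a : ℂ) (k : ℕ) (t : ℝ) :
    ∑' n, millerRossTerm l ν a (k, n) t = l ^ k * millerRoss (ν * k) a t := by
  simp only [millerRossTerm, millerRoss, tsum_mul_left]

theorem millerRoss_zero (a z : ℂ) : millerRoss 0 a z = Complex.exp (a * z) := by
  simp only [millerRoss, Complex.cpow_zero, one_mul, zero_add, Complex.Gamma_nat_eq_factorial]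
  rw [Complex.exp_eq_exp_ℂ]
  exact (NormedSpace.expSeries_div_hasSum_exp (a * z)).tsum_eq

/-- Fractional integration shifts the outer index of the double series. -/
theorem integral_abel_kernel_mul_millerRossTerm (l : ℂ) {ν : ℂ} (hν : 0 < ν.re) (a : ℂ) {t : ℝ}
    (ht : 0 < t) (k n : ℕ) :
    l * ((1 / Complex.Gamma ν) *
      ∫ s in (0 : ℝ)..t, ((t - s : ℝ) : ℂ) ^ (ν - 1) * millerRossTerm l ν a (k, n) s) =
      millerRossTerm l ν a (k + 1, n) t := by
  have hu := re_mul_natCast_add_natCast_add_one_pos hν k n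
  have hΓu := Complex.Gamma_ne_zero_of_re_pos hu
  have hΓν := Complex.Gamma_ne_zero_of_re_pos hν
  have ht' : (t : ℂ) ≠ 0 := Complex.ofReal_ne_zero.2 ht.ne'
  have h : ∫ s in (0 : ℝ)..t, ((t - s : ℝ) : ℂ) ^ (ν - 1) * millerRossTerm l ν a (k, n) s =
      ∫ s in (0 : ℝ)..t, (l ^ k * a ^ n / Complex.Gamma (ν * k + n + 1)) *
        ((s : ℂ) ^ ((ν * k + n + 1) - 1) * ((t : ℂ) - s) ^ (ν - 1)) := by
    refine intervalIntegral.integral_congr_ae (.of_forall fun s hs => ?_)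
    rw [Set.uIoc_of_le ht.le] at hs
    have hs' : (s : ℂ) ≠ 0 := Complex.ofReal_ne_zero.2 hs.1.ne'
    rw [add_sub_cancel_right, Complex.cpow_add _ _ hs', Complex.cpow_natCast]
    simp only [millerRossTerm, mul_pow, Complex.ofReal_sub]
    ring
  rw [h, intervalIntegral.integral_const_mul, Complex.betaIntegral_scaled _ _ ht,
    Complex.betaIntegral_eq_Gamma_mul_div _ _ hu hν,
    show ν * k + n + 1 + ν - 1 = ν * (k + 1 : ℕ) + n by push_cast; ring,
    show ν * k + n + 1 + ν = ν * (k + 1 : ℕ) + n + 1 by push_cast; ring,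
    Complex.cpow_add _ _ ht', Complex.cpow_natCast]
  simp only [millerRossTerm, mul_pow, pow_succ]
  field_simp

theorem measurable_millerRossTerm (l ν a : ℂ) (p : ℕ × ℕ) :
    Measurable (millerRossTerm l ν a p) := by
  unfold millerRossTerm
  fun_prop

theorem hasSum_integral_abel_kernel_mul_millerRossTerm (l : ℂ) {ν : ℂ} (hν : 0 < ν.re) (a : ℂ)
    {t : ℝ} (ht : 0 < t) :
    HasSum (fun p => ∫ s in (0 : ℝ)..t, ((t - s : ℝ) : ℂ) ^ (ν - 1) * millerRossTerm l ν a p s)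
      (∫ s in (0 : ℝ)..t, ((t - s : ℝ) : ℂ) ^ (ν - 1) * ∑' p, millerRossTerm l ν a p s) := by
  have hg := summable_millerRossMajorant l hν a ht.le
  refine intervalIntegral.hasSum_integral_of_dominated_convergence
    (fun p s => ‖((t - s : ℝ) : ℂ) ^ (ν - 1)‖ * millerRossMajorant l ν a t p) (fun p => ?_)
    (fun p => .of_forall fun s hs => ?_) (.of_forall fun _ _ => hg.mul_left _) ?_
    (.of_forall fun s hs => ?_)
  · have := measurable_millerRossTerm l ν a p
    exact Measurable.aestronglyMeasurable (by fun_prop)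
  · rw [Set.uIoc_of_le ht.le] at hs
    rw [norm_mul]
    gcongr
    exact norm_millerRossTerm_le l hν a hs.1 hs.2 p
  · simp only [tsum_mul_left]
    exact (intervalIntegrable_abel_kernel hν t).norm.mul_const _
  · rw [Set.uIoc_of_le ht.le] at hs
    exact (summable_millerRossTerm l hν a hs.1).hasSum.mul_left _

theorem tsum_millerRossTerm (l : ℂ) {ν : ℂ} (hν : 0 < ν.re) (a : ℂ) {t : ℝ} (ht : 0 < t) :
    ∑' p, millerRossTerm l ν a p t = ∑' k : ℕ, l ^ k * millerRoss (ν * k) a t := by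
  simp only [(summable_millerRossTerm l hν a ht).tsum_prod, tsum_millerRossTerm_mk]

/-- The Volterra equation satisfied by the Miller-Ross series. -/
theorem tsum_millerRoss_sub_exp (l : ℂ) {ν : ℂ} (hν : 0 < ν.re) (a : ℂ) {t : ℝ} (ht : 0 < t) :
    ∑' k : ℕ, l ^ k * millerRoss (ν * k) a t - Complex.exp (a * t) =
      l * ((1 / Complex.Gamma ν) * ∫ s in (0 : ℝ)..t, ((t - s : ℝ) : ℂ) ^ (ν - 1) *
        ∑' k : ℕ, l ^ k * millerRoss (ν * k) a s) := by
  have hint : ∫ s in (0 : ℝ)..t, ((t - s : ℝ) : ℂ) ^ (ν - 1) *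
        ∑' k : ℕ, l ^ k * millerRoss (ν * k) a s =
      ∫ s in (0 : ℝ)..t, ((t - s : ℝ) : ℂ) ^ (ν - 1) * ∑' p, millerRossTerm l ν a p s := by
    refine intervalIntegral.integral_congr_ae (.of_forall fun s hs => ?_)
    rw [Set.uIoc_of_le ht.le] at hs
    rw [tsum_millerRossTerm l hν a hs.1]
  have hshift := ((hasSum_integral_abel_kernel_mul_millerRossTerm l hν a ht).mul_left
    (1 / Complex.Gamma ν)).mul_left l
  simp only [integral_abel_kernel_mul_millerRossTerm l hν a ht] at hshift
  rw [hint, ← hshift.tsum_eq, hshift.summable.tsum_prod]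
  have hsum := (summable_millerRossTerm l hν a ht).prod
  simp only [tsum_millerRossTerm_mk] at hsum ⊢
  rw [hsum.tsum_eq_zero_add]
  simp [millerRoss_zero]

open MeasureTheory intervalIntegral in
/-- Theorem 7.2, component form: `N(t) = N₀ ∑_{k=0}^∞ (−c^ν)^k E_{νk,a}(t)` solves
the fractional integral equation `N(t) − N₀ exp(at) = −c^ν D_t^{−ν} N(t)`, where
`D_t^{−ν} f(t) = (1/Γ(ν)) ∫₀^t (t−s)^{ν−1} f(s) ds`. -/
theorem fractional_kinetic_exp_solution (c : ℝ) (hc : 0 < c) (ν : ℂ) (hν : 0 < ν.re)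
    (a N₀ : ℂ) (N : ℝ → ℂ)
    (hN : ∀ t : ℝ, N t =
      N₀ * ∑' k : ℕ, (-((c : ℂ) ^ ν)) ^ k * millerRoss (ν * (k : ℂ)) a (t : ℂ)) :
    ∀ t : ℝ, 0 < t →
      N t - N₀ * Complex.exp (a * (t : ℂ)) =
        -((c : ℂ) ^ ν) *
          ((1 / Complex.Gamma ν) * ∫ s in (0:ℝ)..t, ((t - s : ℝ) : ℂ) ^ (ν - 1) * N s) := by
  intro t ht
  have h := tsum_millerRoss_sub_exp (-((c : ℂ) ^ ν)) hν a ht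
  simp only [hN, mul_left_comm _ N₀, intervalIntegral.integral_const_mul]
  rw [← mul_sub, h]
end
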